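/- arXiv:1703.01929 — 7 statements merged into one kernel-verified Lean document; each statement's English description precedes it below -/
import Mathlib

section
/- Let n ≥ 1 and let R and P be real symmetric n×n matrices such that R is positive definite, P is invertible, and R and P commute (R·P = P·R). Then there exists a complex number λ with Re λ > 0 such that det(λ²·(1 : Matrix) + R.map ℂ + Complex.I • P.map ℂ) = 0; i.e., the undamped complex system q̈ + (R + iP)q = 0 has an eigenvalue with positive real part, so stable levitation without dissipative forces is impossible. -/
open Matrix

/-- If `S` and `P` are commuting real symmetric matrices and `P` is invertible, then `S + iP` is
nonsingular. -/
theorem det_ofReal_add_I_smul_ne_zero {ι : Type*} [Fintype ι] [DecidableEq ι]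
    {S P : Matrix ι ι ℝ} (hS : S.IsSymm) (hP : P.IsSymm) (hPinv : IsUnit P)
    (hcomm : S * P = P * S) :
    (S.map Complex.ofReal + Complex.I • P.map Complex.ofReal).det ≠ 0 := by
  intro h
  have hpos : (S * S + P * P).PosDef := by
    have h1 : (Sᴴ * S).PosSemidef := posSemidef_conjTranspose_mul_self S
    have h2 : (Pᴴ * P).PosDef :=
      PosDef.conjTranspose_mul_self P (mulVec_injective_iff_isUnit.mpr hPinv)
    rw [conjTranspose_eq_transpose_of_trivial, hS.eq] at h1
    rw [conjTranspose_eq_transpose_of_trivial, hP.eq] at h2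
    exact PosDef.posSemidef_add h1 h2
  have hmap : (S * S + P * P).map Complex.ofReal =
      (S.map Complex.ofReal + Complex.I • P.map Complex.ofReal) *
        (S.map Complex.ofReal - Complex.I • P.map Complex.ofReal) := by
    have hc : S.map Complex.ofReal * P.map Complex.ofReal =
        P.map Complex.ofReal * S.map Complex.ofReal := by
      have := congrArg (fun M => M.map Complex.ofRealHom) hcomm
      simp only [Matrix.map_mul] at this
      exact this
    have e : (S * S + P * P).map Complex.ofReal =
        S.map Complex.ofReal * S.map Complex.ofReal +
          P.map Complex.ofReal * P.map Complex.ofReal := by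
      have : (S * S + P * P).map Complex.ofRealHom = _ :=
        Matrix.map_add _ (map_add Complex.ofRealHom) (S * S) (P * P)
      simp only [Matrix.map_mul] at this
      exact this
    rw [e, add_mul, mul_sub, mul_sub]
    simp only [Matrix.smul_mul, Matrix.mul_smul, smul_smul, Complex.I_mul_I, hc, neg_smul, one_smul]
    abel
  have hdet : (((S * S + P * P).det : ℝ) : ℂ) = 0 := by
    calc (((S * S + P * P).det : ℝ) : ℂ) = ((S * S + P * P).map Complex.ofReal).det :=
          RingHom.map_det Complex.ofRealHom _
      _ = 0 := by rw [hmap, det_mul, h, zero_mul]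
  exact hpos.det_pos.ne' (Complex.ofReal_eq_zero.mp hdet)

/-- Every non-real complex number has a square root with positive real part. -/
theorem Complex.exists_sq_eq_re_pos_of_im_ne_zero {z : ℂ} (hz : z.im ≠ 0) :
    ∃ w : ℂ, 0 < w.re ∧ w ^ 2 = z := by
  obtain ⟨w, hw⟩ := IsAlgClosed.exists_pow_nat_eq z two_pos
  have hre : w.re ≠ 0 := by
    intro h
    apply hz
    rw [← hw, sq, Complex.mul_im, h]
    ring
  rcases lt_or_gt_of_ne hre with h | h
  · exact ⟨-w, by simpa using h, by rw [neg_sq, hw]⟩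
  · exact ⟨w, h, hw⟩

/-- **Unstable levitation I** (commuting-coefficients version).
If `R` is a real symmetric positive definite matrix, `P` is a real symmetric
invertible matrix, and `R` and `P` commute, then the undamped complex system
`q̈ + (R + iP) q = 0` has an eigenvalue with positive real part. -/
theorem unstable_levitation_I (n : ℕ) (hn : 1 ≤ n)
    (R P : Matrix (Fin n) (Fin n) ℝ)
    (hRsymm : R.IsSymm) (hPsymm : P.IsSymm)
    (hRpos : R.PosDef) (hPinv : IsUnit P)
    (hcomm : R * P = P * R) :
    ∃ lam : ℂ, 0 < lam.re ∧
      (lam ^ 2 • (1 : Matrix (Fin n) (Fin n) ℂ)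
        + R.map Complex.ofReal
        + Complex.I • P.map Complex.ofReal).det = 0 := by
  have : Nonempty (Fin n) := ⟨⟨0, hn⟩⟩
  obtain ⟨μ, hμ⟩ := spectrum.nonempty_of_isAlgClosed_of_finiteDimensional ℂ
    (R.map Complex.ofReal + Complex.I • P.map Complex.ofReal)
  rw [spectrum.mem_iff, isUnit_iff_isUnit_det, isUnit_iff_ne_zero, not_not,
    Algebra.algebraMap_eq_smul_one] at hμ
  have hdet : (-μ • (1 : Matrix (Fin n) (Fin n) ℂ) + R.map Complex.ofReal
      + Complex.I • P.map Complex.ofReal).det = 0 := by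
    have e : -μ • (1 : Matrix (Fin n) (Fin n) ℂ) + R.map Complex.ofReal
        + Complex.I • P.map Complex.ofReal
        = -(μ • 1 - (R.map Complex.ofReal + Complex.I • P.map Complex.ofReal)) := by
      rw [neg_smul]
      abel
    rw [e, det_neg, hμ, mul_zero]
  have him : (-μ).im ≠ 0 := by
    intro h
    have hreal : -μ = ((-μ).re : ℂ) := Complex.ext rfl (by simpa using h)
    refine det_ofReal_add_I_smul_ne_zero (S := (-μ).re • 1 + R) (P := P)
      ((isSymm_one.smul _).add hRsymm) hPsymm hPinv ?_ ?_
    · simp [add_mul, mul_add, hcomm]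
    · rw [← hdet]
      congr 2
      rw [hreal]
      ext i j
      by_cases hij : i = j <;> simp [hij]
  obtain ⟨w, hw, hsq⟩ := Complex.exists_sq_eq_re_pos_of_im_ne_zero him
  exact ⟨w, hw, by rw [hsq, hdet]⟩
end

section
/- Let n ≥ 1 and let P be a nonzero real symmetric n×n matrix. Then there exists a complex number λ with Re λ > 0 such that det(λ²·(1 : Matrix ℂ) + Complex.I • P.map ℂ) = 0. That is, for a suspension subjected to only nonconservative positional electromagnetic forces, with no potential part (R = 0) and no damping, stable levitation is impossible. -/
open Matrix

lemma exists_sq_eq_neg_I_mul_ofReal {t : ℝ} (ht : t ≠ 0) :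
    ∃ z : ℂ, 0 < z.re ∧ z ^ 2 = -(Complex.I * t) := by
  have exists_pos_sq (a : ℝ) (ha : 0 < a) : ∃ s : ℝ, 0 < s ∧ s * s = a :=
    ⟨√a, Real.sqrt_pos.2 ha, Real.mul_self_sqrt ha.le⟩
  rcases lt_or_gt_of_ne ht with h | h
  · obtain ⟨s, hs, hst⟩ := exists_pos_sq (-t / 2) (by linarith)
    refine ⟨⟨s, s⟩, hs, ?_⟩
    apply Complex.ext <;> simp [pow_two]
    linarith
  · obtain ⟨s, hs, hst⟩ := exists_pos_sq (t / 2) (by linarith)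
    refine ⟨⟨s, -s⟩, hs, ?_⟩
    apply Complex.ext <;> simp [pow_two]
    linarith

/-- **Corollary 1.1.** For a suspension subjected to only nonconservative
positional electromagnetic forces `iP` (with `P` nonzero real symmetric),
no potential part and no damping, there is an eigenvalue with positive real
part, so stable levitation is impossible. -/
theorem unstable_levitation_no_potential (n : ℕ) (hn : 1 ≤ n)
    (P : Matrix (Fin n) (Fin n) ℝ) (hPsymm : P.IsSymm) (hP : P ≠ 0) :
    ∃ lam : ℂ, 0 < lam.re ∧
      (lam ^ 2 • (1 : Matrix (Fin n) (Fin n) ℂ)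
        + Complex.I • P.map Complex.ofReal).det = 0 := by
  have hH : P.IsHermitian := by rwa [IsHermitian, conjTranspose_eq_transpose_of_trivial]
  obtain ⟨v, t, ht, hv, hPv⟩ := hH.exists_eigenvector_of_ne_zero hP
  obtain ⟨z, hz, hz2⟩ := exists_sq_eq_neg_I_mul_ofReal ht
  refine ⟨z, hz, exists_mulVec_eq_zero_iff.1 ⟨Complex.ofReal ∘ v, fun h => hv ?_, ?_⟩⟩
  · ext i
    simpa using congrFun h i
  · have hmap : P.map Complex.ofReal *ᵥ (Complex.ofReal ∘ v) = (t : ℂ) • (Complex.ofReal ∘ v) := by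
      ext i
      exact (Complex.ofRealHom.map_mulVec P v i).symm.trans (by simp [hPv])
    rw [add_mulVec, smul_mulVec, smul_mulVec, one_mulVec, hmap, hz2, smul_smul, neg_smul,
      neg_add_cancel]
end

section
/- Let n ≥ 1 and let B and P be real symmetric n×n matrices such that B is positive definite, P is nonzero, and B and P commute (B·P = P·B). Then there exists a complex number λ with Re λ > 0 such that det(λ²·(1 : Matrix) + λ·B.map ℂ + Complex.I • P.map ℂ) = 0; i.e., a system subjected to nonconservative positional forces iP and dissipative forces B, with no potential forces (R = 0), has an eigenvalue with positive real part, so stable levitation is impossible. -/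
open Matrix

/-- A quadratic `z² + b z + i p` with `p ≠ 0` real and `b` real has a root in the open right
half-plane. -/
theorem exists_re_pos_root (b : ℝ) {p : ℝ} (hp : p ≠ 0) :
    ∃ z : ℂ, 0 < z.re ∧ z ^ 2 + z * b + Complex.I * p = 0 := by
  obtain ⟨d, hd, hre⟩ : ∃ d : ℂ, d ^ 2 = b ^ 2 - 4 * Complex.I * p ∧ 0 ≤ d.re := by
    obtain ⟨d, hd⟩ := IsAlgClosed.exists_pow_nat_eq ((b : ℂ) ^ 2 - 4 * Complex.I * p) two_pos
    rcases le_total 0 d.re with h | h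
    · exact ⟨d, hd, h⟩
    · exact ⟨-d, by rw [neg_sq, hd], by simpa using h⟩
  have h_re := congrArg Complex.re hd
  have h_im := congrArg Complex.im hd
  simp [pow_two] at h_re h_im
  have him : d.im ≠ 0 := by
    intro h
    apply hp
    rw [h] at h_im
    linarith
  have hb : b < d.re := by
    have := sq_pos_of_ne_zero him
    exact lt_of_pow_lt_pow_left₀ 2 hre (by nlinarith)
  refine ⟨(-b + d) / 2, ?_, ?_⟩
  · have h2 : ((-b + d) / 2 : ℂ).re = (-b + d.re) / 2 := by
      rw [Complex.div_ofNat_re]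
      simp
    rw [h2]
    linarith
  · linear_combination hd / 4

/-- Two commuting real symmetric matrices, the first of them nonzero, have a common eigenvector
belonging to a nonzero eigenvalue of the first. -/
theorem Matrix.exists_common_eigenvector_of_commute {ι : Type*} [Fintype ι] [DecidableEq ι]
    {P B : Matrix ι ι ℝ} (hP : P.IsSymm) (hB : B.IsSymm) (hP0 : P ≠ 0) (hPB : Commute P B) :
    ∃ (p b : ℝ) (v : ι → ℝ), p ≠ 0 ∧ v ≠ 0 ∧ P *ᵥ v = p • v ∧ B *ᵥ v = b • v := by
  have hPs : P.toEuclideanLin.IsSymmetric :=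
    isSymmetric_toEuclideanLin_iff.mpr (isHermitian_iff_isSymm.mpr hP)
  have hBs : B.toEuclideanLin.IsSymmetric :=
    isSymmetric_toEuclideanLin_iff.mpr (isHermitian_iff_isSymm.mpr hB)
  have hcomm : Commute P.toEuclideanLin B.toEuclideanLin := by
    change _ * _ = _ * _
    rw [Module.End.mul_eq_comp, Module.End.mul_eq_comp, ← toLpLin_mul_same,
      ← toLpLin_mul_same, hPB.eq]
  by_contra! hne
  have htop := LinearMap.IsSymmetric.iSup_iSup_eigenspace_inf_eigenspace_eq_top_of_commute
    hPs hBs hcomm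
  have hker : LinearMap.ker P.toEuclideanLin = ⊤ := by
    rw [eq_top_iff, ← htop]
    refine iSup₂_le fun p b v ⟨hv, hw⟩ => ?_
    have hv := Module.End.mem_eigenspace_iff.mp hv
    have hw := Module.End.mem_eigenspace_iff.mp hw
    rw [LinearMap.mem_ker, hv]
    by_cases hp : p = 0
    · simp [hp]
    by_cases hv0 : v.ofLp = 0
    · rw [(WithLp.ofLp_eq_zero 2).mp hv0, smul_zero]
    · exact absurd (congrArg WithLp.ofLp hw)
        (hne p b v.ofLp hp hv0 (congrArg WithLp.ofLp hv))
  exact hP0 (toEuclideanLin.map_eq_zero_iff.mp (LinearMap.ker_eq_top.mp hker))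

/-- **Unstable levitation II** (commuting-coefficients version).
A system subjected to nonconservative positional forces `iP` (`P ≠ 0`) and
dissipative forces `B > 0` commuting with `P`, but no potential forces,
has an eigenvalue with positive real part: stable levitation is impossible. -/
theorem unstable_levitation_II (n : ℕ) (hn : 1 ≤ n)
    (B P : Matrix (Fin n) (Fin n) ℝ)
    (hBsymm : B.IsSymm) (hPsymm : P.IsSymm)
    (hBpos : B.PosDef) (hP : P ≠ 0)
    (hcomm : B * P = P * B) :
    ∃ lam : ℂ, 0 < lam.re ∧
      (lam ^ 2 • (1 : Matrix (Fin n) (Fin n) ℂ)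
        + lam • B.map Complex.ofReal
        + Complex.I • P.map Complex.ofReal).det = 0 := by
  obtain ⟨p, b, v, hp, hv, hPv, hBv⟩ :=
    Matrix.exists_common_eigenvector_of_commute hPsymm hBsymm hP hcomm.symm
  obtain ⟨z, hz, hroot⟩ := exists_re_pos_root b hp
  have map_eigen : ∀ (M : Matrix (Fin n) (Fin n) ℝ) (c : ℝ), M *ᵥ v = c • v →
      M.map Complex.ofReal *ᵥ (Complex.ofReal ∘ v) = (c : ℂ) • (Complex.ofReal ∘ v) := by
    intro M c h
    ext i
    have hi := congrArg Complex.ofReal (congrFun h i)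
    simpa [mulVec, dotProduct] using hi
  refine ⟨z, hz, exists_mulVec_eq_zero_iff.mp ⟨Complex.ofReal ∘ v, ?_, ?_⟩⟩
  · intro h
    exact hv (funext fun i => Complex.ofReal_eq_zero.mp (congrFun h i))
  · rw [add_mulVec, add_mulVec, smul_mulVec, smul_mulVec, smul_mulVec, one_mulVec,
      map_eigen B b hBv, map_eigen P p hPv, smul_smul, smul_smul, ← add_smul, ← add_smul,
      hroot, zero_smul]
end

section
/- Let n ≥ 1, let μ > 0 be a real number, and let P be a nonzero real symmetric n×n matrix. Then there exists a complex number λ with Re λ > 0 such that det(λ²·(1 : Matrix) + μ·λ·(1 : Matrix) + Complex.I • P.map ℂ) = 0. That is, uniform viscous damping μ·I cannot stabilize a system subjected only to nonzero nonconservative positional forces iP with no potential forces. -/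
open Matrix

/-- A nonzero real symmetric matrix has a nonzero real eigenvalue. -/
theorem Matrix.IsSymm.exists_ne_zero_det_sub_smul_one_eq_zero {ι : Type*} [Fintype ι]
    [DecidableEq ι] {P : Matrix ι ι ℝ} (hPsymm : P.IsSymm) (hP : P ≠ 0) :
    ∃ p : ℝ, p ≠ 0 ∧ (P - p • (1 : Matrix ι ι ℝ)).det = 0 := by
  have hH : P.IsHermitian := by
    rw [Matrix.IsHermitian, conjTranspose_eq_transpose_of_trivial]
    exact hPsymm
  obtain ⟨i, hi⟩ := Function.ne_iff.mp (mt hH.eigenvalues_eq_zero_iff.mp hP)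
  refine ⟨hH.eigenvalues i, hi, exists_mulVec_eq_zero_iff.mp
    ⟨hH.eigenvectorBasis i, ?_, ?_⟩⟩
  · intro h
    exact hH.eigenvectorBasis.orthonormal.ne_zero i (by ext j; exact congrFun h j)
  · rw [sub_mulVec, hH.mulVec_eigenvectorBasis, smul_mulVec, one_mulVec, sub_self]

/-- The quadratic `z² + μ z + i p` with real `μ` and `p ≠ 0` has a root in the open right
half-plane. -/
theorem Complex.exists_re_pos_sq_add_mul_add_I_mul_eq_zero (μ : ℝ) {p : ℝ} (hp : p ≠ 0) :
    ∃ z : ℂ, 0 < z.re ∧ z ^ 2 + μ * z + Complex.I * p = 0 := by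
  obtain ⟨s, hs, hs0⟩ : ∃ s : ℂ, s ^ 2 = μ ^ 2 - 4 * (Complex.I * p) ∧ 0 ≤ s.re := by
    obtain ⟨s, hs⟩ := IsAlgClosed.exists_pow_nat_eq
      ((μ : ℂ) ^ 2 - 4 * (Complex.I * p)) (n := 2) (by norm_num)
    rcases le_total 0 s.re with h | h
    · exact ⟨s, hs, h⟩
    · exact ⟨-s, by rw [neg_sq, hs], by simpa using h⟩
  have hre : s.re ^ 2 - s.im ^ 2 = μ ^ 2 := by
    have := congrArg Complex.re hs
    simp [pow_two] at this
    linarith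
  have him : s.re * s.im = -2 * p := by
    have := congrArg Complex.im hs
    simp [pow_two] at this
    linarith
  have hb : s.im ≠ 0 := by
    intro h
    rw [h, mul_zero] at him
    exact hp (by linarith)
  have hlt : μ < s.re := lt_of_pow_lt_pow_left₀ 2 hs0 (by have := sq_pos_of_ne_zero hb; linarith)
  refine ⟨(s - μ) / 2, ?_, by linear_combination hs / 4⟩
  rw [Complex.div_ofNat_re, Complex.sub_re, Complex.ofReal_re]
  linarith

/-- **Unstable levitation II** (uniform damping instance).
Uniform viscous damping `μ • I` cannot stabilize a system subjected only to
a nonzero nonconservative positional force `iP` with no potential forces. -/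
theorem unstable_levitation_uniform_damping (n : ℕ) (hn : 1 ≤ n)
    (μ : ℝ) (hμ : 0 < μ)
    (P : Matrix (Fin n) (Fin n) ℝ) (hPsymm : P.IsSymm) (hP : P ≠ 0) :
    ∃ lam : ℂ, 0 < lam.re ∧
      (lam ^ 2 • (1 : Matrix (Fin n) (Fin n) ℂ)
        + ((μ : ℂ) * lam) • (1 : Matrix (Fin n) (Fin n) ℂ)
        + Complex.I • P.map Complex.ofReal).det = 0 := by
  obtain ⟨p, hp, hdet⟩ := hPsymm.exists_ne_zero_det_sub_smul_one_eq_zero hP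
  obtain ⟨z, hz, hroot⟩ := Complex.exists_re_pos_sq_add_mul_add_I_mul_eq_zero μ hp
  refine ⟨z, hz, ?_⟩
  have hM : z ^ 2 • (1 : Matrix (Fin n) (Fin n) ℂ) + ((μ : ℂ) * z) • 1
      + Complex.I • P.map Complex.ofReal
      = Complex.I • Complex.ofRealHom.mapMatrix (P - p • 1) := by
    ext i j
    simp [one_apply]
    split_ifs
    · linear_combination hroot
    · simp
  rw [hM, det_smul, ← RingHom.map_det, hdet, map_zero, mul_zero]
end

section
/- Let A, B, R be real symmetric positive definite n×n matrices and P a real symmetric n×n matrix. Let a_max > 0, μ_min > 0, r_min > 0 and p_max ≥ 0 be real numbers such that for every complex vector v the (real) Hermitian quadratic forms satisfy ⟨v, A·v⟩ ≤ a_max·‖v‖², ⟨v, B·v⟩ ≥ μ_min·‖v‖², ⟨v, R·v⟩ ≥ r_min·‖v‖², and |⟨v, P·v⟩| ≤ p_max·‖v‖². If Metelitsyn's inequality μ_min > p_max·√(a_max / r_min) holds, then every complex number λ with det(λ²·A.map ℂ + λ·B.map ℂ + R.map ℂ + Complex.I • P.map ℂ) = 0 satisfies Re λ < 0; hence the suspension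 is asymptotically stable. -/
open Matrix

/-- The Hermitian form of a real symmetric matrix at a complex vector splits into the quadratic forms
at the real and imaginary parts. -/
theorem Matrix.IsSymm.star_dotProduct_map_ofReal_mulVec {ι : Type*} [Fintype ι]
    {M : Matrix ι ι ℝ} (hM : M.IsSymm) (v : ι → ℂ) :
    star v ⬝ᵥ (M.map Complex.ofReal).mulVec v =
      (((fun i => (v i).re) ⬝ᵥ M.mulVec (fun i => (v i).re) +
        (fun i => (v i).im) ⬝ᵥ M.mulVec (fun i => (v i).im) : ℝ) : ℂ) := by
  have hswap : ∑ i, ∑ j, (v i).im * (M i j * (v j).re) =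
      ∑ i, ∑ j, (v i).re * (M i j * (v j).im) := by
    rw [Finset.sum_comm]
    refine Finset.sum_congr rfl fun i _ => Finset.sum_congr rfl fun j _ => ?_
    rw [hM.apply]
    ring
  apply Complex.ext
  · simp [dotProduct, mulVec, Finset.mul_sum, Finset.sum_add_distrib]
  · simp [dotProduct, mulVec, Finset.mul_sum, Finset.sum_add_distrib, hswap]

/-- Metelitsyn's criterion for a scalar quadratic polynomial: if `p ^ 2 * a < b ^ 2 * r`, the roots of
`a z ^ 2 + b z + r + i p` lie in the open left half-plane. -/
theorem re_neg_of_quadratic_eq_zero {a b r p : ℝ} (ha : 0 ≤ a) (hb : 0 < b)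
    (h : p ^ 2 * a < b ^ 2 * r) {z : ℂ}
    (hz : z ^ 2 * a + z * b + r + Complex.I * p = 0) : z.re < 0 := by
  obtain ⟨x, y⟩ := z
  by_contra! hx
  change 0 ≤ x at hx
  have hre := congrArg Complex.re hz
  have him := congrArg Complex.im hz
  simp [pow_two] at hre him
  have hax : 0 ≤ a * x := mul_nonneg ha hx
  have hp : p ^ 2 = y ^ 2 * (2 * (a * x) + b) ^ 2 := by
    rw [show p = -(y * (2 * (a * x) + b)) by linarith]
    ring
  have hbp : y ^ 2 * b ^ 2 ≤ p ^ 2 := by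
    rw [hp]
    gcongr
    linarith
  have hay : r ≤ a * y ^ 2 := by nlinarith [mul_nonneg hax hx, mul_nonneg hb.le hx]
  have := mul_le_mul_of_nonneg_right hbp ha
  have := mul_le_mul_of_nonneg_left hay (sq_nonneg b)
  linarith

/-- **Asymptotically stable levitation** (Theorem 3, Metelitsyn's condition).
If the Hermitian quadratic forms of the real symmetric positive definite
matrices `A`, `B`, `R` and of the real symmetric matrix `P` are bounded by
`a_max`, `μ_min`, `r_min`, `p_max` (relative to `‖v‖² = (star v ⬝ᵥ v).re`),
and Metelitsyn's inequality `μ_min > p_max * √(a_max / r_min)` holds, then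
every eigenvalue of the quadratic pencil `λ²A + λB + R + iP` has negative
real part. -/
theorem asymptotically_stable_levitation (n : ℕ)
    (A B R P : Matrix (Fin n) (Fin n) ℝ)
    (hAsymm : A.IsSymm) (hBsymm : B.IsSymm) (hRsymm : R.IsSymm) (hPsymm : P.IsSymm)
    (hApos : A.PosDef) (hBpos : B.PosDef) (hRpos : R.PosDef)
    (a_max μ_min r_min p_max : ℝ)
    (ha : 0 < a_max) (hμ : 0 < μ_min) (hr : 0 < r_min) (hp : 0 ≤ p_max)
    (hA : ∀ v : Fin n → ℂ,
      (star v ⬝ᵥ (A.map Complex.ofReal).mulVec v).re ≤ a_max * (star v ⬝ᵥ v).re)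
    (hB : ∀ v : Fin n → ℂ,
      μ_min * (star v ⬝ᵥ v).re ≤ (star v ⬝ᵥ (B.map Complex.ofReal).mulVec v).re)
    (hR : ∀ v : Fin n → ℂ,
      r_min * (star v ⬝ᵥ v).re ≤ (star v ⬝ᵥ (R.map Complex.ofReal).mulVec v).re)
    (hP : ∀ v : Fin n → ℂ,
      |(star v ⬝ᵥ (P.map Complex.ofReal).mulVec v).re| ≤ p_max * (star v ⬝ᵥ v).re)
    (hMet : μ_min > p_max * Real.sqrt (a_max / r_min)) :
    ∀ lam : ℂ,
      (lam ^ 2 • A.map Complex.ofReal + lam • B.map Complex.ofReal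
        + R.map Complex.ofReal + Complex.I • P.map Complex.ofReal).det = 0 →
      lam.re < 0 := by
  intro lam hdet
  obtain ⟨v, hv, hker⟩ := exists_mulVec_eq_zero_iff.mpr hdet
  have hN : 0 < (star v ⬝ᵥ v).re := by
    open scoped ComplexOrder in
    exact (Complex.pos_iff.mp (dotProduct_star_self_pos_iff.mpr hv)).1
  have hform := congrArg (star v ⬝ᵥ ·) hker
  simp only [add_mulVec, smul_mulVec, dotProduct_add, dotProduct_smul, dotProduct_zero,
    smul_eq_mul] at hform
  have hAnonneg : 0 ≤ (star v ⬝ᵥ (A.map Complex.ofReal).mulVec v).re := by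
    rw [hAsymm.star_dotProduct_map_ofReal_mulVec, Complex.ofReal_re]
    exact add_nonneg (hApos.posSemidef.dotProduct_mulVec_nonneg _)
      (hApos.posSemidef.dotProduct_mulVec_nonneg _)
  have hreal {M : Matrix (Fin n) (Fin n) ℝ} (hM : M.IsSymm) :
      star v ⬝ᵥ (M.map Complex.ofReal).mulVec v =
        ((star v ⬝ᵥ (M.map Complex.ofReal).mulVec v).re : ℂ) := by
    rw [hM.star_dotProduct_map_ofReal_mulVec, Complex.ofReal_re]
  rw [hreal hAsymm, hreal hBsymm, hreal hRsymm, hreal hPsymm] at hform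
  specialize hA v
  specialize hB v
  specialize hR v
  specialize hP v
  generalize (star v ⬝ᵥ v).re = N at *
  have hMet' : p_max ^ 2 * a_max < μ_min ^ 2 * r_min := by
    have hsq := pow_lt_pow_left₀ hMet (by positivity) two_ne_zero
    rw [mul_pow, Real.sq_sqrt (by positivity), ← mul_div_assoc] at hsq
    exact (div_lt_iff₀ hr).mp hsq
  refine re_neg_of_quadratic_eq_zero hAnonneg ((mul_pos hμ hN).trans_le hB) ?_ hform
  calc _ ≤ (p_max * N) ^ 2 * (a_max * N) :=
        mul_le_mul (sq_le_sq.mpr (hP.trans (le_abs_self _))) hA hAnonneg (sq_nonneg _)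
    _ = p_max ^ 2 * a_max * N ^ 3 := by ring
    _ < μ_min ^ 2 * r_min * N ^ 3 := by gcongr
    _ = (μ_min * N) ^ 2 * (r_min * N) := by ring
    _ ≤ _ := by gcongr
end

section
/- Let α > 0, β > 0, γ > 0 and δ be real numbers. Then every complex root λ of the complex quadratic α·λ² + β·λ + (γ + i·δ) = 0 satisfies Re λ < 0 if and only if β²·γ > α·δ². -/
/-- Scalar stability criterion underlying Metelitsyn's inequality:
for `α, β, γ > 0` and `δ` real, every complex root of
`α λ² + β λ + (γ + i δ) = 0` has negative real part iff `β² γ > α δ²`. -/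
theorem scalar_stability_criterion (α β γ δ : ℝ)
    (hα : 0 < α) (hβ : 0 < β) (hγ : 0 < γ) :
    (∀ lam : ℂ,
        (α : ℂ) * lam ^ 2 + (β : ℂ) * lam + ((γ : ℂ) + Complex.I * (δ : ℂ)) = 0 →
        lam.re < 0) ↔ β ^ 2 * γ > α * δ ^ 2 := by
  constructor
  · intro h
    obtain ⟨s, hs⟩ := IsAlgClosed.exists_pow_nat_eq
      ((β : ℂ) ^ 2 - 4 * α * (γ + Complex.I * δ)) (n := 2) two_pos
    have root_re_neg (t : ℂ) (ht : t ^ 2 = s ^ 2) : t.re < β := by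
      have hαc : (α : ℂ) ≠ 0 := by exact_mod_cast hα.ne'
      have hroot := h ((t - β) / ((2 * α : ℝ) : ℂ)) (by
        push_cast
        field_simp
        linear_combination ht + hs)
      rw [Complex.div_ofReal_re, div_neg_iff] at hroot
      simp only [Complex.sub_re, Complex.ofReal_re] at hroot
      rcases hroot with hroot | hroot <;> linarith
    have hu := root_re_neg s rfl
    have hu' := root_re_neg (-s) (by ring)
    rw [Complex.neg_re] at hu'
    have hre := congrArg Complex.re hs
    have him := congrArg Complex.im hs
    simp [pow_two] at hre him
    have hu2 : s.re ^ 2 < β ^ 2 := by nlinarith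
    have hv2 : s.im ^ 2 < 4 * α * γ := by nlinarith
    have huv : s.re * s.im = -(2 * α * δ) := by linarith
    have hprod : s.re ^ 2 * s.im ^ 2 < β ^ 2 * (4 * α * γ) :=
      mul_lt_mul'' hu2 hv2 (sq_nonneg _) (sq_nonneg _)
    rw [← mul_pow, huv] at hprod
    refine lt_of_mul_lt_mul_left (a := 4 * α) ?_ (by positivity)
    linarith
  · intro h lam hroot
    by_contra! hx
    have hre := congrArg Complex.re hroot
    have him := congrArg Complex.im hroot
    simp [pow_two] at hre him
    have hδ : δ = -(lam.im * (2 * α * lam.re + β)) := by linarith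
    have hy : α * lam.im ^ 2 = α * lam.re ^ 2 + β * lam.re + γ := by linarith
    have hαδ : α * δ ^ 2
        = (α * lam.re ^ 2 + β * lam.re + γ) * (2 * α * lam.re + β) ^ 2 := by
      rw [← hy, hδ]; ring
    have hγ_le : γ ≤ α * lam.re ^ 2 + β * lam.re + γ := by
      have : 0 ≤ α * lam.re ^ 2 + β * lam.re := by positivity
      linarith
    have hβ_le : β ≤ 2 * α * lam.re + β := by
      have : 0 ≤ 2 * α * lam.re := by positivity
      linarith
    have : γ * β ^ 2 ≤ α * δ ^ 2 := by
      rw [hαδ]; gcongr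
    linarith
end

section
/- Let μ > 0 and a ≠ 0 be real numbers. Then there exists a complex number λ satisfying λ² + μ·λ + i·a = 0 whose real part equals (−μ + √((√(μ⁴ + 16·a²) + μ²)/2))/2, and this real part is strictly positive. -/
/-- Scalar root computation for the damped oscillator with purely positional
stiffness: for `μ > 0` and `a ≠ 0`, the quadratic `λ² + μ λ + i a = 0` has a
root whose real part equals `(−μ + √((√(μ⁴ + 16 a²) + μ²)/2))/2`, and this
real part is strictly positive. -/
theorem damped_positional_scalar_root (μ a : ℝ) (hμ : 0 < μ) (ha : a ≠ 0) :
    ∃ lam : ℂ, lam ^ 2 + (μ : ℂ) * lam + Complex.I * (a : ℂ) = 0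
      ∧ lam.re = (-μ + Real.sqrt ((Real.sqrt (μ ^ 4 + 16 * a ^ 2) + μ ^ 2) / 2)) / 2
      ∧ 0 < lam.re := by
  set S := Real.sqrt (μ ^ 4 + 16 * a ^ 2)
  set P := Real.sqrt ((S + μ ^ 2) / 2)
  have hS : S ^ 2 = μ ^ 4 + 16 * a ^ 2 := Real.sq_sqrt (by positivity)
  have hP : P ^ 2 = (S + μ ^ 2) / 2 := Real.sq_sqrt (by positivity)
  have hSμ : μ ^ 2 < S := Real.lt_sqrt_of_sq_lt (by nlinarith [sq_pos_of_ne_zero ha])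
  have hPμ : μ < P := Real.lt_sqrt_of_sq_lt (by linarith)
  have hP0 : P ≠ 0 := (hμ.trans hPμ).ne'
  have hquartic : P ^ 4 - μ ^ 2 * P ^ 2 = 4 * a ^ 2 := by
    linear_combination (P ^ 2 + (S - μ ^ 2) / 2) * hP + hS / 4
  refine ⟨⟨(-μ + P) / 2, -a / P⟩, ?_, rfl, by dsimp only; linarith⟩
  apply Complex.ext
  · simp [pow_two]
    field_simp
    linear_combination hquartic
  · simp [pow_two]
    field_simp
    ring
end
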